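/- Let s ≥ 1. There exists a constant C > 0, depending only on s, p and Ω, such that for every t ∈ ℝ and all φ, η in the appropriate Sobolev spaces: (i) ‖∂_t² F_t(φ)‖_s ≤ C ‖φ‖_{s+1}^{p+1} for φ ∈ H^{s+1}(Ω); and (ii) ‖∂_t F_t'(φ)(η)‖_s ≤ C ‖φ‖_s^{p} ‖η‖_s for φ, η ∈ H^s(Ω), where F_t'(φ)(η) = e^{−it⟨∇⟩}F'(e^{it⟨∇⟩}φ)(e^{it⟨∇⟩}η) and F'(φ)(η) = ((p+1)i/2^{p+1}) ⟨∇⟩^{−1}((φ + φ̄)^p (η + η̄)). -/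

import Mathlib

/- Periodic functions on Ω = (a,b) are represented by their Fourier coefficient
sequences `c : ℤ → ℂ`, i.e. `z(x) = ∑_{l∈ℤ} c l * exp(i μ_l (x−a))` with
`μ_l = 2πl/(b−a)`.  All operators are expressed on the Fourier side:
`⟨∇⟩`, `⟨∇⟩⁻¹`, `e^{it⟨∇⟩}` act diagonally, complex conjugation of the function
corresponds to `l ↦ conj (c (−l))`, and the pointwise product of two functions
corresponds to the convolution of their coefficient sequences. -/

noncomputable section

namespace NKGE

/-- Fourier frequency `μ_l = 2πl/(b−a)`. -/
def mu (a b : ℝ) (l : ℤ) : ℝ := 2 * Real.pi * l / (b - a)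

/-- `ζ_l = √(1+μ_l²)`, the Fourier symbol of `⟨∇⟩ = √(1−∂_xx)`. -/
def zeta (a b : ℝ) (l : ℤ) : ℝ := Real.sqrt (1 + mu a b l ^ 2)

/-- Squared `H^s`-norm: `‖z‖_s² = ∑_l (1+μ_l²)^s |ẑ_l|²`. -/
def sobNormSq (a b s : ℝ) (c : ℤ → ℂ) : ℝ := ∑' l : ℤ, (1 + mu a b l ^ 2) ^ s * ‖c l‖ ^ 2

/-- The `H^s`-norm `‖z‖_s`. -/
def sobNorm (a b s : ℝ) (c : ℤ → ℂ) : ℝ := Real.sqrt (sobNormSq a b s c)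

/-- Membership in `H^s(Ω)`. -/
def MemHs (a b s : ℝ) (c : ℤ → ℂ) : Prop :=
  Summable fun l : ℤ => (1 + mu a b l ^ 2) ^ s * ‖c l‖ ^ 2

/-- The operator `⟨∇⟩` acting in Fourier space. -/
def opJ (a b : ℝ) (c : ℤ → ℂ) : ℤ → ℂ := fun l => (zeta a b l : ℂ) * c l

/-- The operator `⟨∇⟩⁻¹` acting in Fourier space. -/
def opJinv (a b : ℝ) (c : ℤ → ℂ) : ℤ → ℂ := fun l => c l / (zeta a b l : ℂ)

/-- The operator `e^{it⟨∇⟩}` acting in Fourier space. -/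
def expJ (a b t : ℝ) (c : ℤ → ℂ) : ℤ → ℂ :=
  fun l => Complex.exp (Complex.I * (t : ℂ) * (zeta a b l : ℂ)) * c l

/-- Fourier coefficients of the complex conjugate function `z̄`. -/
def conjC (c : ℤ → ℂ) : ℤ → ℂ := fun l => (starRingEnd ℂ) (c (-l))

/-- Convolution of coefficient sequences = coefficients of the pointwise product. -/
def convC (c d : ℤ → ℂ) : ℤ → ℂ := fun l => ∑' m : ℤ, c m * d (l - m)

/-- Coefficients of the constant function `1`. -/
def oneC : ℤ → ℂ := fun l => if l = 0 then 1 else 0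

/-- Coefficients of the `n`-th pointwise power `z^n`. -/
def powC (c : ℤ → ℂ) : ℕ → ℤ → ℂ
  | 0 => oneC
  | n + 1 => convC c (powC c n)

/-- Coefficients of `(ψ + ψ̄)/2`. -/
def reC (c : ℤ → ℂ) : ℤ → ℂ := fun l => (c l + conjC c l) / 2

/-- Coefficients of `φ + φ̄`. -/
def addConj (c : ℤ → ℂ) : ℤ → ℂ := fun l => c l + conjC c l

/-- `G(φ) = f((φ+φ̄)/2)` with `f(v) = v^{p+1}`. -/
def Gop (p : ℕ) (c : ℤ → ℂ) : ℤ → ℂ := powC (reC c) (p + 1)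

/-- `F(φ) = i ⟨∇⟩⁻¹ G(φ)`. -/
def Fop (a b : ℝ) (p : ℕ) (c : ℤ → ℂ) : ℤ → ℂ := fun l => Complex.I * opJinv a b (Gop p c) l

/-- `F_t(φ) = e^{−it⟨∇⟩} F(e^{it⟨∇⟩} φ)`. -/
def Ft (a b : ℝ) (p : ℕ) (t : ℝ) (c : ℤ → ℂ) : ℤ → ℂ :=
  expJ a b (-t) (Fop a b p (expJ a b t c))

/-- `F'(φ)(η) = ((p+1)i/2^{p+1}) ⟨∇⟩⁻¹((φ+φ̄)^p (η+η̄))`. -/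
def Fd (a b : ℝ) (p : ℕ) (φ η : ℤ → ℂ) : ℤ → ℂ :=
  fun l => ((p : ℂ) + 1) * Complex.I / 2 ^ (p + 1) *
    opJinv a b (convC (powC (addConj φ) p) (addConj η)) l

/-- `F_t'(φ)(η) = e^{−it⟨∇⟩} F'(e^{it⟨∇⟩}φ)(e^{it⟨∇⟩}η)`. -/
def Ftd (a b : ℝ) (p : ℕ) (t : ℝ) (φ η : ℤ → ℂ) : ℤ → ℂ :=
  expJ a b (-t) (Fd a b p (expJ a b t φ) (expJ a b t η))

/-- `F''(φ)(η,ζ) = (p(p+1)i/2^{p+1}) ⟨∇⟩⁻¹((φ+φ̄)^{p−1}(η+η̄)(ζ+ζ̄))`. -/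
def Fdd (a b : ℝ) (p : ℕ) (φ η ζ : ℤ → ℂ) : ℤ → ℂ :=
  fun l => (p : ℂ) * ((p : ℂ) + 1) * Complex.I / 2 ^ (p + 1) *
    opJinv a b (convC (convC (powC (addConj φ) (p - 1)) (addConj η)) (addConj ζ)) l

/-- `F_t''(φ)(η,ζ) = e^{−it⟨∇⟩} F''(e^{it⟨∇⟩}φ)(e^{it⟨∇⟩}η, e^{it⟨∇⟩}ζ)`. -/
def Ftdd (a b : ℝ) (p : ℕ) (t : ℝ) (φ η ζ : ℤ → ℂ) : ℤ → ℂ :=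
  expJ a b (-t) (Fdd a b p (expJ a b t φ) (expJ a b t η) (expJ a b t ζ))

/-- The flow `φ_V^t(ψ₀) = ψ₀ + ε^p t F(ψ₀)` of the nonlinear subproblem. -/
def flowV (a b : ℝ) (p : ℕ) (ε t : ℝ) (c : ℤ → ℂ) : ℤ → ℂ :=
  fun l => c l + (ε ^ p * t) • Fop a b p c l

/-- The Strang splitting operator `S_τ = φ_T^{τ/2} ∘ φ_V^{τ} ∘ φ_T^{τ/2}`. -/
def strang (a b : ℝ) (p : ℕ) (ε τ : ℝ) (c : ℤ → ℂ) : ℤ → ℂ :=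
  expJ a b (τ / 2) (flowV a b p ε τ (expJ a b (τ / 2) c))

/-- The alternative Strang splitting `S̃_τ = φ_V^{τ/2} ∘ φ_T^{τ} ∘ φ_V^{τ/2}`. -/
def strang2 (a b : ℝ) (p : ℕ) (ε τ : ℝ) (c : ℤ → ℂ) : ℤ → ℂ :=
  flowV a b p ε (τ / 2) (expJ a b τ (flowV a b p ε (τ / 2) c))

/-- `Ψ` is an exact solution of the relativistic NLSE
`i∂_tψ + ⟨∇⟩ψ + ε^p ⟨∇⟩⁻¹ G(ψ) = 0`, written on the Fourier side, i.e.
`ψ' = i(ζ_l ψ_l + ε^p ζ_l⁻¹ (G(ψ))_l)`. -/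
def IsExactSol (a b : ℝ) (p : ℕ) (ε : ℝ) (Ψ : ℝ → ℤ → ℂ) : Prop :=
  ∀ (t : ℝ) (l : ℤ), HasDerivAt (fun s => Ψ s l)
    (Complex.I * ((zeta a b l : ℂ) * Ψ t l + (ε ^ p : ℂ) * Gop p (Ψ t) l / (zeta a b l : ℂ))) t

/-- Pointwise-in-`t` derivative `∂_t F_t(φ)`. -/
def dFt (a b : ℝ) (p : ℕ) (t : ℝ) (c : ℤ → ℂ) : ℤ → ℂ :=
  fun l => deriv (fun τ => Ft a b p τ c l) t

/-- Second derivative `∂_t² F_t(φ)`. -/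
def d2Ft (a b : ℝ) (p : ℕ) (t : ℝ) (c : ℤ → ℂ) : ℤ → ℂ :=
  fun l => deriv (fun τ => dFt a b p τ c l) t

/-- Derivative `∂_t F_t'(φ)(η)`. -/
def dFtd (a b : ℝ) (p : ℕ) (t : ℝ) (φ η : ℤ → ℂ) : ℤ → ℂ :=
  fun l => deriv (fun τ => Ftd a b p τ φ η l) t


open scoped ENNReal NNReal

def W (a b : ℝ) (l : ℤ) : ℝ≥0∞ := ENNReal.ofReal (1 + mu a b l ^ 2)

def NN (a b σ : ℝ) (A : ℤ → ℝ≥0∞) : ℝ≥0∞ := ∑' l, W a b l ^ σ * A l ^ 2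

def cv (A B : ℤ → ℝ≥0∞) (l : ℤ) : ℝ≥0∞ := ∑' m, A m * B (l - m)

lemma one_le_W (a b : ℝ) (l : ℤ) : 1 ≤ W a b l := by
  unfold W
  rw [← ENNReal.ofReal_one]
  exact ENNReal.ofReal_le_ofReal (by nlinarith [sq_nonneg (mu a b l)])

lemma W_ne_zero (a b : ℝ) (l : ℤ) : W a b l ≠ 0 :=
  (lt_of_lt_of_le zero_lt_one (one_le_W a b l)).ne'

lemma W_ne_top (a b : ℝ) (l : ℤ) : W a b l ≠ ⊤ := ENNReal.ofReal_ne_top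

lemma W_neg (a b : ℝ) (l : ℤ) : W a b (-l) = W a b l := by
  unfold W mu
  congr 2
  push_cast
  ring

lemma W_tri (a b : ℝ) (l m : ℤ) : W a b l ≤ 2 * (W a b m + W a b (l - m)) := by
  unfold W
  rw [← ENNReal.ofReal_add (by positivity) (by positivity)]
  rw [show (2 : ℝ≥0∞) = ENNReal.ofReal 2 by simp, ← ENNReal.ofReal_mul (by norm_num)]
  apply ENNReal.ofReal_le_ofReal
  have : mu a b l = mu a b m + mu a b (l - m) := by
    unfold mu; push_cast; ring
  rw [this]
  nlinarith [sq_nonneg (mu a b m - mu a b (l - m))]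

lemma W_tri_rpow (a b ρ : ℝ) (hρ : 0 ≤ ρ) (l m : ℤ) :
    W a b l ^ ρ ≤ 4 ^ ρ * (W a b m ^ ρ + W a b (l - m) ^ ρ) := by
  have h := W_tri a b l m
  rcases le_total (W a b m) (W a b (l - m)) with h1 | h1
  · calc W a b l ^ ρ ≤ (4 * W a b (l - m)) ^ ρ := by
          apply ENNReal.rpow_le_rpow _ hρ
          calc _ ≤ _ := h
            _ ≤ 2 * (W a b (l - m) + W a b (l - m)) := by gcongr
            _ = _ := by ring
      _ = 4 ^ ρ * W a b (l - m) ^ ρ := ENNReal.mul_rpow_of_nonneg _ _ hρ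
      _ ≤ _ := by gcongr; exact le_add_self
  · calc W a b l ^ ρ ≤ (4 * W a b m) ^ ρ := by
          apply ENNReal.rpow_le_rpow _ hρ
          calc _ ≤ _ := h
            _ ≤ 2 * (W a b m + W a b m) := by gcongr
            _ = _ := by ring
      _ = 4 ^ ρ * W a b m ^ ρ := ENNReal.mul_rpow_of_nonneg _ _ hρ
      _ ≤ _ := by gcongr; exact le_self_add

lemma sumW (a b : ℝ) (hab : a < b) : ∑' l, (W a b l)⁻¹ ≠ ⊤ := by
  have hk : 0 < (2 * Real.pi / (b - a)) ^ 2 := by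
    have : 0 < b - a := by linarith
    have := Real.pi_pos
    positivity
  have hs : Summable fun l : ℤ => (1 + mu a b l ^ 2)⁻¹ := by
    have h0 : Summable fun l : ℤ => ((2 * Real.pi / (b - a)) ^ 2)⁻¹ * (1 / (l : ℝ) ^ 2) :=
      (Real.summable_one_div_int_pow.mpr (by norm_num)).mul_left _
    refine Summable.of_norm_bounded_eventually h0 ?_
    have : ∀ᶠ l : ℤ in Filter.cofinite, l ≠ 0 := by
      rw [Filter.eventually_cofinite]
      simp
    filter_upwards [this] with l hl
    have hl' : (0 : ℝ) < (l : ℝ) ^ 2 := by positivity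
    rw [Real.norm_of_nonneg (by positivity), one_div, ← mul_inv]
    apply inv_anti₀ (by positivity)
    have : mu a b l ^ 2 = (2 * Real.pi / (b - a)) ^ 2 * (l : ℝ) ^ 2 := by
      unfold mu; ring
    linarith
  have : (fun l => (W a b l)⁻¹) = fun l => ENNReal.ofReal ((1 + mu a b l ^ 2)⁻¹) := by
    ext l
    unfold W
    rw [ENNReal.ofReal_inv_of_pos (by positivity)]
  rw [this]
  exact hs.tsum_ofReal_ne_top

lemma wcs {ι : Type*} (w x : ι → ℝ≥0∞) :
    (∑' i, w i * x i) ^ 2 ≤ (∑' i, w i) * ∑' i, w i * x i ^ 2 := by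
  have h : ∑' i, w i * x i ≤ ((∑' i, w i) * ∑' i, w i * x i ^ 2) ^ (1 / 2 : ℝ) := by
    rw [ENNReal.tsum_eq_iSup_sum]
    refine iSup_le fun s => ?_
    refine (ENNReal.inner_le_weight_mul_Lp_of_nonneg s (p := 2) (by norm_num) w x).trans ?_
    rw [show (1 - (2 : ℝ)⁻¹) = 1 / 2 by norm_num, show ((2 : ℝ)⁻¹) = 1 / 2 by norm_num,
      ← ENNReal.mul_rpow_of_nonneg _ _ (by norm_num)]
    apply ENNReal.rpow_le_rpow _ (by norm_num)
    gcongr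
    · exact ENNReal.sum_le_tsum s
    · simp only [ENNReal.rpow_two]
      exact ENNReal.sum_le_tsum s
  calc _ ≤ (((∑' i, w i) * ∑' i, w i * x i ^ 2) ^ (1 / 2 : ℝ)) ^ 2 := by gcongr
    _ = _ := by
      rw [← ENNReal.rpow_two, ← ENNReal.rpow_mul]; norm_num

lemma L1_le (a b : ℝ) (A : ℤ → ℝ≥0∞) :
    (∑' l, A l) ^ 2 ≤ (∑' l, (W a b l)⁻¹) * NN a b 1 A := by
  have h := wcs (fun l => (W a b l)⁻¹) (fun l => W a b l * A l)
  have e1 : ∀ l, (W a b l)⁻¹ * (W a b l * A l) = A l := fun l => by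
    rw [← mul_assoc, ENNReal.inv_mul_cancel (W_ne_zero a b l) (W_ne_top a b l), one_mul]
  have e2 : ∀ l, (W a b l)⁻¹ * (W a b l * A l) ^ 2 = W a b l ^ (1 : ℝ) * A l ^ 2 := fun l => by
    rw [sq, ← mul_assoc, e1, ENNReal.rpow_one]; ring
  simp only [e1, e2] at h
  exact h

lemma cv_comm (A B : ℤ → ℝ≥0∞) : cv A B = cv B A := by
  ext l
  unfold cv
  rw [← (Equiv.subLeft l).tsum_eq]
  simp [mul_comm]

lemma tsum_shift (B : ℤ → ℝ≥0∞) (m : ℤ) : ∑' l, B (l - m) = ∑' l, B l :=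
  (Equiv.subRight m).tsum_eq B

lemma young (A B : ℤ → ℝ≥0∞) :
    ∑' l, cv A B l ^ 2 ≤ (∑' l, A l) ^ 2 * ∑' l, B l ^ 2 := by
  calc ∑' l, cv A B l ^ 2 ≤ ∑' l, (∑' m, A m) * ∑' m, A m * B (l - m) ^ 2 :=
        ENNReal.tsum_le_tsum fun l => wcs _ _
    _ = (∑' m, A m) * ∑' m, ∑' l, A m * B (l - m) ^ 2 := by
        rw [ENNReal.tsum_mul_left, ENNReal.tsum_comm]
    _ = _ := by
        have : ∀ m, ∑' l, A m * B (l - m) ^ 2 = A m * ∑' l, B l ^ 2 := fun m => by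
          rw [ENNReal.tsum_mul_left, tsum_shift (fun l => B l ^ 2)]
        simp only [this]
        rw [ENNReal.tsum_mul_right]; ring

lemma young' (A B : ℤ → ℝ≥0∞) :
    ∑' l, cv A B l ^ 2 ≤ (∑' l, A l ^ 2) * (∑' l, B l) ^ 2 := by
  rw [cv_comm, mul_comm]; exact young B A

lemma add_sq_le' (x y : ℝ≥0∞) : (x + y) ^ 2 ≤ 2 * (x ^ 2 + y ^ 2) := by
  have := ENNReal.rpow_add_le_mul_rpow_add_rpow x y (p := 2) (by norm_num)
  simp only [ENNReal.rpow_two] at this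
  norm_num at this
  exact this

/-- multiply by weight -/
def wt (a b ρ : ℝ) (A : ℤ → ℝ≥0∞) : ℤ → ℝ≥0∞ := fun l => W a b l ^ (ρ / 2) * A l

lemma Wsq (a b ρ : ℝ) (l : ℤ) : (W a b l ^ (ρ / 2)) ^ 2 = W a b l ^ ρ := by
  rw [← ENNReal.rpow_two, ← ENNReal.rpow_mul]; congr 1; ring

lemma NN_wt (a b ρ σ : ℝ) (A : ℤ → ℝ≥0∞) : NN a b σ (wt a b ρ A) = NN a b (σ + ρ) A := by
  unfold NN wt
  congr 1; ext l
  rw [mul_pow, Wsq, ENNReal.rpow_add _ _ (W_ne_zero a b l) (W_ne_top a b l)]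
  ring

lemma NN_zero (a b : ℝ) (A : ℤ → ℝ≥0∞) : NN a b 0 A = ∑' l, A l ^ 2 := by
  unfold NN; simp

lemma NN_mono (a b : ℝ) {σ ρ : ℝ} (h : σ ≤ ρ) {A B : ℤ → ℝ≥0∞} (hA : ∀ l, A l ≤ B l) :
    NN a b σ A ≤ NN a b ρ B := by
  unfold NN
  refine ENNReal.tsum_le_tsum fun l => ?_
  gcongr
  · exact one_le_W a b l
  · exact hA l

lemma NN_add (a b σ : ℝ) (A B : ℤ → ℝ≥0∞) :
    NN a b σ (fun l => A l + B l) ≤ 2 * (NN a b σ A + NN a b σ B) := by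
  unfold NN
  rw [← ENNReal.tsum_add, ← ENNReal.tsum_mul_left]
  refine ENNReal.tsum_le_tsum fun l => ?_
  calc W a b l ^ σ * (A l + B l) ^ 2 ≤ W a b l ^ σ * (2 * (A l ^ 2 + B l ^ 2)) := by
        gcongr; exact add_sq_le' _ _
    _ = _ := by ring

lemma NN_cv_split (a b σ : ℝ) (hσ : 0 ≤ σ) (A B : ℤ → ℝ≥0∞) :
    NN a b σ (cv A B) ≤ 2 * (4 ^ σ) *
      (∑' l, cv (wt a b σ A) B l ^ 2 + ∑' l, cv A (wt a b σ B) l ^ 2) := by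
  unfold NN
  rw [← ENNReal.tsum_add, ← ENNReal.tsum_mul_left]
  refine ENNReal.tsum_le_tsum fun l => ?_
  have h : W a b l ^ (σ / 2) * cv A B l ≤
      4 ^ (σ / 2) * (cv (wt a b σ A) B l + cv A (wt a b σ B) l) := by
    unfold cv wt
    rw [← ENNReal.tsum_add, ← ENNReal.tsum_mul_left, ← ENNReal.tsum_mul_left]
    refine ENNReal.tsum_le_tsum fun m => ?_
    calc _ ≤ (4 ^ (σ / 2) * (W a b m ^ (σ / 2) + W a b (l - m) ^ (σ / 2))) * (A m * B (l - m)) := by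
          gcongr; exact W_tri_rpow a b _ (by linarith) l m
      _ = _ := by ring
  calc W a b l ^ σ * cv A B l ^ 2 = (W a b l ^ (σ / 2) * cv A B l) ^ 2 := by
        rw [mul_pow, Wsq]
    _ ≤ (4 ^ (σ / 2) * (cv (wt a b σ A) B l + cv A (wt a b σ B) l)) ^ 2 := by gcongr
    _ = 4 ^ σ * (cv (wt a b σ A) B l + cv A (wt a b σ B) l) ^ 2 := by
        rw [mul_pow, ← ENNReal.rpow_two, ← ENNReal.rpow_mul]; congr 2; ring
    _ ≤ 4 ^ σ * (2 * (cv (wt a b σ A) B l ^ 2 + cv A (wt a b σ B) l ^ 2)) := by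
        gcongr; exact add_sq_le' _ _
    _ = _ := by ring

lemma prod_bounds (a b : ℝ) (hab : a < b) (σ : ℝ) (hσ : 1 ≤ σ) :
    ∃ C : ℝ≥0, (∀ A B, NN a b σ (cv A B) ≤ C * (NN a b σ A * NN a b σ B)) ∧
      (∀ A B, NN a b (σ - 1) (cv A B) ≤ C * (NN a b (σ - 1) A * NN a b σ B)) ∧
      (∀ A B, NN a b (σ - 1) (cv A B) ≤ C * (NN a b σ A * NN a b (σ - 1) B)) := by
  set S := ∑' l, (W a b l)⁻¹ with hS
  have hSt : S ≠ ⊤ := sumW a b hab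
  have hct : 4 * (4 : ℝ≥0∞) ^ σ * S ≠ ⊤ := by
    refine ENNReal.mul_ne_top (ENNReal.mul_ne_top (by norm_num) ?_) hSt
    exact ENNReal.rpow_ne_top_of_nonneg (by linarith) (by norm_num)
  have key : ∀ A B, NN a b (σ - 1) (cv A B) ≤
      (4 * (4 : ℝ≥0∞) ^ σ * S) * (NN a b (σ - 1) A * NN a b σ B) := by
    intro A B
    refine (NN_cv_split a b (σ - 1) (by linarith) A B).trans ?_
    have h1 : ∑' l, cv (wt a b (σ - 1) A) B l ^ 2 ≤ S * (NN a b (σ - 1) A * NN a b σ B) := by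
      refine (young' _ _).trans ?_
      rw [← NN_zero a b, NN_wt, zero_add]
      calc _ ≤ NN a b (σ - 1) A * (S * NN a b 1 B) := by gcongr; exact L1_le a b B
        _ ≤ NN a b (σ - 1) A * (S * NN a b σ B) := by
            gcongr; exact NN_mono a b hσ fun _ => le_rfl
        _ = _ := by ring
    have h2 : ∑' l, cv A (wt a b (σ - 1) B) l ^ 2 ≤ S * (NN a b (σ - 1) A * NN a b σ B) := by
      refine (young' _ _).trans ?_
      rw [← NN_zero a b]
      calc _ ≤ NN a b 0 A * (S * NN a b 1 (wt a b (σ - 1) B)) := by gcongr; exact L1_le a b _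
        _ ≤ NN a b (σ - 1) A * (S * NN a b σ B) := by
            rw [NN_wt, add_sub_cancel]
            gcongr; exact NN_mono a b (by linarith) fun _ => le_rfl
        _ = _ := by ring
    calc _ ≤ 2 * (4 : ℝ≥0∞) ^ σ * (S * (NN a b (σ - 1) A * NN a b σ B)
            + S * (NN a b (σ - 1) A * NN a b σ B)) := by
          gcongr
          · norm_num
          · linarith
      _ = _ := by ring
  refine ⟨(4 * (4 : ℝ≥0∞) ^ σ * S).toNNReal, ?_, ?_, ?_⟩
  all_goals
    intro A B
    rw [ENNReal.coe_toNNReal hct]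
  · refine (NN_cv_split a b σ (by linarith) A B).trans ?_
    have h1 : ∑' l, cv (wt a b σ A) B l ^ 2 ≤ S * (NN a b σ A * NN a b σ B) := by
      refine (young' _ _).trans ?_
      rw [← NN_zero a b, NN_wt, zero_add]
      calc _ ≤ NN a b σ A * (S * NN a b 1 B) := by gcongr; exact L1_le a b B
        _ ≤ NN a b σ A * (S * NN a b σ B) := by
            gcongr; exact NN_mono a b hσ fun _ => le_rfl
        _ = _ := by ring
    have h2 : ∑' l, cv A (wt a b σ B) l ^ 2 ≤ S * (NN a b σ A * NN a b σ B) := by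
      refine (young _ _).trans ?_
      rw [← NN_zero a b, NN_wt, zero_add]
      calc _ ≤ (S * NN a b 1 A) * NN a b σ B := by gcongr; exact L1_le a b A
        _ ≤ (S * NN a b σ A) * NN a b σ B := by
            gcongr; exact NN_mono a b hσ fun _ => le_rfl
        _ = _ := by ring
    calc _ ≤ 2 * (4 : ℝ≥0∞) ^ σ * (S * (NN a b σ A * NN a b σ B)
            + S * (NN a b σ A * NN a b σ B)) := by gcongr
      _ = _ := by ring
  · exact key A B
  · rw [cv_comm, mul_comm (NN a b σ A)]; exact key B A

lemma NN_finite (a b σ : ℝ) (hσ : 0 ≤ σ) (A : ℤ → ℝ≥0∞) (h : NN a b σ A ≠ ⊤) (l : ℤ) : A l ≠ ⊤ := by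
  intro hl
  apply h
  rw [← top_le_iff]
  refine le_trans ?_ (ENNReal.le_tsum l)
  rw [hl]
  have : W a b l ^ σ ≠ 0 := by
    intro h0
    rw [ENNReal.rpow_eq_zero_iff] at h0
    rcases h0 with h0 | h0
    · exact W_ne_zero a b l h0.1
    · exact W_ne_top a b l h0.1
  simp [ENNReal.mul_top this]

lemma enorm_zeta (a b : ℝ) (l : ℤ) : ‖(zeta a b l : ℂ)‖ₑ = W a b l ^ (1 / 2 : ℝ) := by
  unfold zeta W
  rw [ENNReal.ofReal_rpow_of_nonneg (by positivity) (by norm_num), ← Real.sqrt_eq_rpow,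
    ← ofReal_norm, Complex.norm_real, Real.norm_of_nonneg (Real.sqrt_nonneg _)]

lemma zeta_pos (a b : ℝ) (l : ℤ) : 0 < zeta a b l := Real.sqrt_pos.mpr (by positivity)

lemma zeta_neg (a b : ℝ) (l : ℤ) : zeta a b (-l) = zeta a b l := by
  unfold zeta mu
  congr 2
  push_cast
  ring

def Good (a b σ : ℝ) (K : ℝ≥0) (f f1 : ℝ → ℤ → ℂ) : Prop :=
  (∀ t l, HasDerivAt (fun τ => f τ l) (f1 t l) t) ∧
  ∃ A0 A1 : ℤ → ℝ≥0∞, (∀ t l, ‖f t l‖ₑ ≤ A0 l) ∧ (∀ t l, ‖f1 t l‖ₑ ≤ A1 l) ∧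
    NN a b σ A0 ≤ K ∧ NN a b (σ - 1) A1 ≤ K

variable {a b σ : ℝ} {K K' : ℝ≥0} {f f1 g g1 : ℝ → ℤ → ℂ}

lemma Good.mono {ρ : ℝ} (h : Good a b ρ K f f1) (h1 : σ ≤ ρ) (h2 : K ≤ K') :
    Good a b σ K' f f1 := by
  obtain ⟨hd, A0, A1, b0, b1, n0, n1⟩ := h
  have h2' : (K : ℝ≥0∞) ≤ K' := by exact_mod_cast h2
  exact ⟨hd, A0, A1, b0, b1, (NN_mono a b h1 fun _ => le_rfl).trans (n0.trans h2'),
    (NN_mono a b (by linarith) fun _ => le_rfl).trans (n1.trans h2')⟩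

lemma Good.add (h : Good a b σ K f f1) (h' : Good a b σ K' g g1) :
    Good a b σ (2 * (K + K')) (fun t l => f t l + g t l) (fun t l => f1 t l + g1 t l) := by
  obtain ⟨hd, A0, A1, b0, b1, n0, n1⟩ := h
  obtain ⟨hd', A0', A1', b0', b1', n0', n1'⟩ := h'
  refine ⟨fun t l => (hd t l).add (hd' t l), fun l => A0 l + A0' l, fun l => A1 l + A1' l,
    fun t l => (enorm_add_le _ _).trans (add_le_add (b0 t l) (b0' t l)),
    fun t l => (enorm_add_le _ _).trans (add_le_add (b1 t l) (b1' t l)), ?_, ?_⟩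
  · refine (NN_add _ _ _ _ _).trans ?_
    push_cast; gcongr
  · refine (NN_add _ _ _ _ _).trans ?_
    push_cast; gcongr

lemma NN_smul (k : ℝ≥0∞) (A : ℤ → ℝ≥0∞) :
    NN a b σ (fun l => k * A l) = k ^ 2 * NN a b σ A := by
  unfold NN
  rw [← ENNReal.tsum_mul_left]
  congr 1; ext l; ring

lemma Good.smul (h : Good a b σ K f f1) (c : ℂ) :
    Good a b σ (‖c‖₊ ^ 2 * K) (fun t l => c * f t l) (fun t l => c * f1 t l) := by
  obtain ⟨hd, A0, A1, b0, b1, n0, n1⟩ := h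
  refine ⟨fun t l => (hd t l).const_mul c, fun l => ‖c‖ₑ * A0 l, fun l => ‖c‖ₑ * A1 l,
    fun t l => ?_, fun t l => ?_, ?_, ?_⟩
  · rw [enorm_mul]; exact mul_le_mul' le_rfl (b0 t l)
  · rw [enorm_mul]; exact mul_le_mul' le_rfl (b1 t l)
  · rw [NN_smul, ENNReal.coe_mul, ENNReal.coe_pow]; exact mul_le_mul' le_rfl n0
  · rw [NN_smul, ENNReal.coe_mul, ENNReal.coe_pow]; exact mul_le_mul' le_rfl n1

lemma Good.wmul (h : Good a b (σ + 1) K f f1) :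
    Good a b σ K (fun t l => -(Complex.I * zeta a b l) * f t l)
      (fun t l => -(Complex.I * zeta a b l) * f1 t l) := by
  obtain ⟨hd, A0, A1, b0, b1, n0, n1⟩ := h
  refine ⟨fun t l => (hd t l).const_mul _, wt a b 1 A0, wt a b 1 A1,
    fun t l => ?_, fun t l => ?_, ?_, ?_⟩
  · rw [enorm_mul, enorm_neg, enorm_mul, enorm_zeta, wt]; gcongr
    · simp [← ofReal_norm]
    · exact b0 t l
  · rw [enorm_mul, enorm_neg, enorm_mul, enorm_zeta, wt]; gcongr
    · simp [← ofReal_norm]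
    · exact b1 t l
  · rwa [NN_wt]
  · rw [NN_wt]; convert n1 using 2; ring

lemma enorm_exp (t x : ℝ) : ‖Complex.exp (Complex.I * (t : ℂ) * (x : ℂ))‖ₑ = 1 := by
  rw [← ofReal_norm, Complex.norm_exp]
  simp

lemma exp_hasDeriv (a b t : ℝ) (l : ℤ) :
    HasDerivAt (fun τ : ℝ => Complex.exp (Complex.I * (τ : ℂ) * (zeta a b l : ℂ)))
      (Complex.exp (Complex.I * (t : ℂ) * (zeta a b l : ℂ)) * (Complex.I * zeta a b l)) t := by
  have h1 : HasDerivAt (fun τ : ℝ => (τ : ℂ)) 1 t := Complex.ofRealCLM.hasDerivAt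
  have h2 := ((h1.const_mul Complex.I).mul_const (zeta a b l : ℂ)).cexp
  convert h2 using 1
  ring

lemma exp_hasDeriv_neg (a b t : ℝ) (l : ℤ) :
    HasDerivAt (fun τ : ℝ => Complex.exp (Complex.I * ((-τ : ℝ) : ℂ) * (zeta a b l : ℂ)))
      (Complex.exp (Complex.I * ((-t : ℝ) : ℂ) * (zeta a b l : ℂ)) * -(Complex.I * zeta a b l)) t := by
  have h := (exp_hasDeriv a b (-t) l).scomp t (hasDerivAt_neg t)
  refine HasDerivAt.congr_deriv h ?_
  simp

lemma Good.exp (h : Good a b σ K f f1) :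
    Good a b σ (4 * K) (fun t => expJ a b (-t) (f t))
      (fun t => expJ a b (-t) (fun l => f1 t l + -(Complex.I * zeta a b l) * f t l)) := by
  obtain ⟨hd, A0, A1, b0, b1, n0, n1⟩ := h
  refine ⟨fun t l => ?_, A0, fun l => A1 l + wt a b 1 A0 l,
    fun t l => ?_, fun t l => ?_, ?_, ?_⟩
  · unfold expJ
    refine HasDerivAt.congr_deriv ((exp_hasDeriv_neg a b t l).mul (hd t l)) ?_
    beta_reduce
    ring
  · unfold expJ; rw [enorm_mul, enorm_exp, one_mul]; exact b0 t l
  · unfold expJ; rw [enorm_mul, enorm_exp, one_mul]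
    refine (enorm_add_le _ _).trans (add_le_add (b1 t l) ?_)
    rw [enorm_mul, enorm_neg, enorm_mul, enorm_zeta, wt]; gcongr
    · simp [← ofReal_norm]
    · exact b0 t l
  · refine n0.trans ?_
    push_cast
    exact le_mul_of_one_le_left (by positivity) (by norm_num)
  · refine (NN_add _ _ _ _ _).trans ?_
    rw [NN_wt, sub_add_cancel]
    calc _ ≤ 2 * ((K : ℝ≥0∞) + K) := by gcongr
      _ = _ := by push_cast; ring

lemma summable_conv {x y : ℤ → ℂ} {A B : ℤ → ℝ≥0∞} {l : ℤ} (hA : ∀ m, ‖x m‖ₑ ≤ A m)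
    (hB : ∀ m, ‖y m‖ₑ ≤ B m) (h : cv A B l ≠ ⊤) : Summable fun m => x m * y (l - m) := by
  refine Summable.of_norm_bounded (ENNReal.summable_toReal h) fun m => ?_
  rw [← toReal_enorm, enorm_mul]
  exact ENNReal.toReal_mono (ENNReal.ne_top_of_tsum_ne_top h m) (mul_le_mul' (hA m) (hB _))

lemma enorm_conv {x y : ℤ → ℂ} {A B : ℤ → ℝ≥0∞} (l : ℤ) (hA : ∀ m, ‖x m‖ₑ ≤ A m)
    (hB : ∀ m, ‖y m‖ₑ ≤ B m) : ‖convC x y l‖ₑ ≤ cv A B l := by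
  unfold convC cv
  refine enorm_tsum_le_tsum_enorm.trans (ENNReal.tsum_le_tsum fun m => ?_)
  rw [enorm_mul]
  exact mul_le_mul' (hA m) (hB _)

lemma good_conv (hab : a < b) (hσ : 1 ≤ σ) : ∃ C : ℝ≥0, ∀ K K' f f1 g g1,
    Good a b σ K f f1 → Good a b σ K' g g1 → Good a b σ (C * (K * K'))
      (fun t => convC (f t) (g t)) (fun t l => convC (f1 t) (g t) l + convC (f t) (g1 t) l) := by
  obtain ⟨C, h0, h1, h2⟩ := prod_bounds a b hab σ hσ
  refine ⟨4 * C, ?_⟩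
  rintro K K' f f1 g g1 ⟨hd, A0, A1, b0, b1, n0, n1⟩ ⟨hd', B0, B1, b0', b1', n0', n1'⟩
  have m00 : NN a b σ (cv A0 B0) ≤ C * (K * K') := (h0 _ _).trans (by gcongr)
  have m10 : NN a b (σ - 1) (cv A1 B0) ≤ C * (K * K') := (h1 _ _).trans (by gcongr)
  have m01 : NN a b (σ - 1) (cv A0 B1) ≤ C * (K * K') := (h2 _ _).trans (by gcongr)
  have ht : ((C : ℝ≥0∞) * (K * K')) ≠ ⊤ := by
    rw [← ENNReal.coe_mul, ← ENNReal.coe_mul]; exact ENNReal.coe_ne_top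
  have f00 := NN_finite a b σ (by linarith) _ (ne_top_of_le_ne_top ht m00)
  have f10 := NN_finite a b (σ - 1) (by linarith) _ (ne_top_of_le_ne_top ht m10)
  have f01 := NN_finite a b (σ - 1) (by linarith) _ (ne_top_of_le_ne_top ht m01)
  refine ⟨fun t l => ?_, cv A0 B0, fun l => cv A1 B0 l + cv A0 B1 l, fun t l => ?_,
    fun t l => ?_, ?_, ?_⟩
  · have hs10 : ∀ t, Summable fun m => f1 t m * g t (l - m) := fun t =>
      summable_conv (b1 t) (b0' t) (f10 l)
    have hs01 : ∀ t, Summable fun m => f t m * g1 t (l - m) := fun t =>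
      summable_conv (b0 t) (b1' t) (f01 l)
    have hs00 : ∀ t, Summable fun m => f t m * g t (l - m) := fun t =>
      summable_conv (b0 t) (b0' t) (f00 l)
    unfold convC
    beta_reduce
    rw [← (hs10 t).tsum_add (hs01 t)]
    refine hasDerivAt_tsum
      (g := fun m τ => f τ m * g τ (l - m))
      (g' := fun m τ => f1 τ m * g τ (l - m) + f τ m * g1 τ (l - m))
      ((ENNReal.summable_toReal (f10 l)).add (ENNReal.summable_toReal (f01 l)))
      (fun m τ => (hd τ m).mul (hd' τ (l - m))) (fun m τ => ?_) (hs00 0) t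
    refine (norm_add_le _ _).trans (add_le_add ?_ ?_)
    · rw [← toReal_enorm, enorm_mul]
      exact ENNReal.toReal_mono (ENNReal.ne_top_of_tsum_ne_top (f10 l) m)
        (mul_le_mul' (b1 τ m) (b0' τ _))
    · rw [← toReal_enorm, enorm_mul]
      exact ENNReal.toReal_mono (ENNReal.ne_top_of_tsum_ne_top (f01 l) m)
        (mul_le_mul' (b0 τ m) (b1' τ _))
  · exact enorm_conv l (b0 t) (b0' t)
  · exact (enorm_add_le _ _).trans
      (add_le_add (enorm_conv l (b1 t) (b0' t)) (enorm_conv l (b0 t) (b1' t)))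
  · refine m00.trans ?_
    push_cast
    rw [mul_assoc]
    exact le_mul_of_one_le_left (by positivity) (by norm_num)
  · refine (NN_add _ _ _ _ _).trans ?_
    calc _ ≤ 2 * ((C : ℝ≥0∞) * (K * K') + C * (K * K')) := by gcongr
      _ = _ := by push_cast; ring

lemma good_one (a b σ : ℝ) : Good a b σ 1 (fun _ => oneC) (fun _ _ => 0) := by
  refine ⟨fun t l => hasDerivAt_const _ _, fun l => if l = 0 then 1 else 0, fun _ => 0,
    fun t l => ?_, fun t l => ?_, ?_, ?_⟩
  · unfold oneC; beta_reduce; split_ifs <;> simp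
  · simp
  · unfold NN
    rw [tsum_eq_single 0 (by intro l hl; simp [hl])]
    simp [W, mu]
  · simp [NN]

lemma good_zero (a b σ : ℝ) : Good a b σ 1 (fun _ _ => 0) (fun _ _ => 0) := by
  refine ⟨fun t l => hasDerivAt_const _ _, fun _ => 0, fun _ => 0,
    fun t l => ?_, fun t l => ?_, ?_, ?_⟩ <;> simp [NN]

lemma NN_reflect (A : ℤ → ℝ≥0∞) : NN a b σ (fun l => A (-l)) = NN a b σ A := by
  unfold NN
  rw [← (Equiv.neg ℤ).tsum_eq]
  simp [W_neg]

/-- derivative of the coefficients -/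
def jay (a b : ℝ) (c : ℤ → ℂ) : ℤ → ℂ := fun l => Complex.I * zeta a b l * c l

lemma enorm_jay (c : ℤ → ℂ) (l : ℤ) : ‖jay a b c l‖ₑ = wt a b 1 (fun l => ‖c l‖ₑ) l := by
  unfold jay wt
  rw [enorm_mul, enorm_mul, enorm_zeta]
  simp [← ofReal_norm]

lemma NN_jay (c : ℤ → ℂ) : NN a b σ (fun l => ‖jay a b c l‖ₑ) = NN a b (σ + 1) (fun l => ‖c l‖ₑ) := by
  rw [← NN_wt]; congr 1; ext l; exact enorm_jay c l

lemma enorm_addConj (t : ℝ) (c : ℤ → ℂ) (l : ℤ) :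
    ‖addConj (expJ a b t c) l‖ₑ ≤ ‖c l‖ₑ + ‖c (-l)‖ₑ := by
  unfold addConj conjC expJ
  refine (enorm_add_le _ _).trans (le_of_eq ?_)
  have : ∀ z : ℂ, ‖(starRingEnd ℂ) z‖ₑ = ‖z‖ₑ := fun z => by
    rw [← ofReal_norm, ← ofReal_norm, RCLike.norm_conj]
  rw [this, enorm_mul, enorm_mul, enorm_exp, enorm_exp, one_mul, one_mul]

lemma good_lin (c : ℤ → ℂ) (hc : NN a b σ (fun l => ‖c l‖ₑ) ≤ K) :
    Good a b σ (4 * K) (fun t => addConj (expJ a b t c)) (fun t => addConj (expJ a b t (jay a b c))) := by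
  have hN : ∀ (ρ : ℝ) (c : ℤ → ℂ), NN a b ρ (fun l => ‖c l‖ₑ) ≤ K →
      NN a b ρ (fun l => ‖c l‖ₑ + ‖c (-l)‖ₑ) ≤ ((4 * K : ℝ≥0) : ℝ≥0∞) := by
    intro ρ c h
    refine (NN_add _ _ _ _ _).trans ?_
    rw [NN_reflect (fun l => ‖c l‖ₑ)]
    calc _ ≤ 2 * ((K : ℝ≥0∞) + K) := by gcongr
      _ = _ := by push_cast; ring
  refine ⟨fun t l => ?_, fun l => ‖c l‖ₑ + ‖c (-l)‖ₑ,
    fun l => ‖jay a b c l‖ₑ + ‖jay a b c (-l)‖ₑ, fun t l => enorm_addConj t c l,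
    fun t l => enorm_addConj t _ l, hN _ _ hc, hN _ _ ?_⟩
  · have h : ∀ l, HasDerivAt (fun τ => expJ a b τ c l) (expJ a b t (jay a b c) l) t := fun l => by
      unfold expJ jay
      refine HasDerivAt.congr_deriv ((exp_hasDeriv a b t l).mul_const (c l)) ?_
      ring
    exact (h l).add (h (-l)).star
  · rw [NN_jay, sub_add_cancel]; exact hc

/-- two-level version -/
def Good2 (a b s : ℝ) (K : ℝ≥0) (f f1 f2 : ℝ → ℤ → ℂ) : Prop :=
  Good a b (s + 1) K f f1 ∧ Good a b s K f1 f2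

lemma good2_conv {s : ℝ} (hab : a < b) (hs : 1 ≤ s) : ∃ C : ℝ≥0, ∀ K K' f f1 f2 g g1 g2,
    Good2 a b s K f f1 f2 → Good2 a b s K' g g1 g2 → ∃ h1 h2, Good2 a b s (C * (K * K'))
      (fun t => convC (f t) (g t)) h1 h2 := by
  obtain ⟨C1, hC1⟩ := good_conv (σ := s + 1) hab (by linarith)
  obtain ⟨C2, hC2⟩ := good_conv (σ := s) hab hs
  refine ⟨C1 + 4 * C2, ?_⟩
  rintro K K' f f1 f2 g g1 g2 ⟨hf, hf1⟩ ⟨hg, hg1⟩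
  have hfm : Good a b s K f f1 := hf.mono (by linarith) le_rfl
  have hgm : Good a b s K' g g1 := hg.mono (by linarith) le_rfl
  refine ⟨_, _, (hC1 _ _ _ _ _ _ hf hg).mono le_rfl ?_,
    ((hC2 _ _ _ _ _ _ hf1 hgm).add (hC2 _ _ _ _ _ _ hfm hg1)).mono le_rfl ?_⟩
  · gcongr; exact le_self_add
  · calc _ = 4 * C2 * (K * K') := by ring
      _ ≤ _ := by gcongr; exact le_add_self

lemma good2_pow {s : ℝ} (hab : a < b) (hs : 1 ≤ s) : ∃ C : ℝ≥0, ∀ K f f1 f2,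
    Good2 a b s K f f1 f2 → ∀ n, ∃ h1 h2, Good2 a b s ((C * K) ^ n)
      (fun t => powC (f t) n) h1 h2 := by
  obtain ⟨C, hC⟩ := good2_conv hab hs
  refine ⟨C, fun K f f1 f2 hf n => ?_⟩
  induction n with
  | zero =>
    refine ⟨_, _, ?_, good_zero a b s |>.mono le_rfl (by simp)⟩
    exact (good_one a b (s + 1)).mono le_rfl (by simp)
  | succ n ih =>
    obtain ⟨h1, h2, h⟩ := ih
    obtain ⟨k1, k2, k⟩ := hC _ _ _ _ _ _ _ _ hf h
    refine ⟨k1, k2, ?_⟩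
    have e : (C * K) ^ (n + 1) = C * (K * (C * K) ^ n) := by ring
    rw [e]
    exact k

lemma good_pow {s : ℝ} (hab : a < b) (hs : 1 ≤ s) : ∃ C : ℝ≥0, ∀ K f f1,
    Good a b s K f f1 → ∀ n, ∃ h1, Good a b s ((C * K) ^ n)
      (fun t => powC (f t) n) h1 := by
  obtain ⟨C, hC⟩ := good_conv hab hs
  refine ⟨C, fun K f f1 hf n => ?_⟩
  induction n with
  | zero => exact ⟨_, (good_one a b s).mono le_rfl (by simp)⟩
  | succ n ih =>
    obtain ⟨h1, h⟩ := ih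
    have k := hC _ _ _ _ _ _ hf h
    have e : (C * K) ^ (n + 1) = C * (K * (C * K) ^ n) := by ring
    rw [e]
    exact ⟨_, k⟩

lemma term_eq (s : ℝ) (c : ℤ → ℂ) (l : ℤ) :
    W a b l ^ s * ‖c l‖ₑ ^ 2 = ENNReal.ofReal ((1 + mu a b l ^ 2) ^ s * ‖c l‖ ^ 2) := by
  have : 0 < 1 + mu a b l ^ 2 := by positivity
  rw [ENNReal.ofReal_mul (by positivity), ENNReal.ofReal_pow (norm_nonneg _), ofReal_norm, W,
    ENNReal.ofReal_rpow_of_pos this]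

lemma sobNormSq_eq (s : ℝ) (c : ℤ → ℂ) :
    sobNormSq a b s c = (NN a b s (fun l => ‖c l‖ₑ)).toReal := by
  unfold NN sobNormSq
  simp only [term_eq]
  rw [ENNReal.tsum_toReal_eq fun _ => ENNReal.ofReal_ne_top]
  congr 1; ext l
  rw [ENNReal.toReal_ofReal (by positivity)]

lemma memHs_NN {s : ℝ} {c : ℤ → ℂ} (h : MemHs a b s c) :
    NN a b s (fun l => ‖c l‖ₑ) ≤ ((sobNorm a b s c ^ 2).toNNReal : ℝ≥0∞) := by
  have hn : NN a b s (fun l => ‖c l‖ₑ) ≠ ⊤ := by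
    unfold NN
    simp only [term_eq]
    exact Summable.tsum_ofReal_ne_top h
  unfold sobNorm
  have : 0 ≤ sobNormSq a b s c := by rw [sobNormSq_eq]; exact ENNReal.toReal_nonneg
  rw [Real.sq_sqrt this, sobNormSq_eq]
  apply le_of_eq
  exact (ENNReal.ofReal_toReal hn).symm

lemma sob_final {s : ℝ} (c : ℂ) (d R : ℤ → ℂ) (hd : ∀ l, d l = c * (Complex.I / zeta a b l * R l))
    (hR : NN a b (s - 1) (fun l => ‖R l‖ₑ) ≤ K) :
    sobNorm a b s d ≤ Real.sqrt (‖c‖ ^ 2 * K) := by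
  unfold sobNorm
  apply Real.sqrt_le_sqrt
  rw [sobNormSq_eq]
  have h1 : NN a b s (fun l => ‖d l‖ₑ) = NN a b (s - 1) (fun l => ‖jay a b d l‖ₑ) := by
    rw [NN_jay, sub_add_cancel]
  have h2 : ∀ l, ‖jay a b d l‖ₑ = ‖c‖ₑ * ‖R l‖ₑ := by
    intro l
    have hz : (zeta a b l : ℂ) ≠ 0 := by exact_mod_cast (zeta_pos a b l).ne'
    have : jay a b d l = -(c * R l) := by
      unfold jay
      rw [hd]
      field_simp
      rw [Complex.I_sq]
      ring
    rw [this, enorm_neg, enorm_mul]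
  rw [h1]
  simp only [h2]
  rw [NN_smul]
  have h3 : ‖c‖ₑ ^ 2 * NN a b (s - 1) (fun l => ‖R l‖ₑ) ≤ ((‖c‖₊ ^ 2 * K : ℝ≥0) : ℝ≥0∞) := by
    rw [ENNReal.coe_mul, ENNReal.coe_pow]; exact mul_le_mul' le_rfl hR
  have := ENNReal.toReal_mono ENNReal.coe_ne_top h3
  simpa using this

lemma part_one (hab : a < b) (p : ℕ) {s : ℝ} (hs : 1 ≤ s) :
    ∃ C : ℝ, 0 ≤ C ∧ ∀ (t : ℝ) (φ : ℤ → ℂ), MemHs a b (s + 1) φ →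
        sobNorm a b s (d2Ft a b p t φ) ≤ C * sobNorm a b (s + 1) φ ^ (p + 1) := by
  obtain ⟨C, hC⟩ := good2_pow hab hs
  refine ⟨Real.sqrt (16 * (C * 4) ^ (p + 1)), Real.sqrt_nonneg _, fun t φ hφ => ?_⟩
  set x := sobNorm a b (s + 1) φ with hx
  have hx0 : 0 ≤ x := Real.sqrt_nonneg _
  have hN := memHs_NN hφ
  rw [← hx] at hN
  set K := (x ^ 2).toNNReal with hK
  have g1 := good_lin φ hN
  have g2 : Good a b s (4 * K) _ _ := good_lin (a := a) (b := b) (σ := s) (jay a b φ)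
    (by rw [NN_jay]; exact hN)
  have hh : ‖(1 / 2 : ℂ)‖₊ ^ 2 * (4 * K) ≤ 4 * K := by
    apply mul_le_of_le_one_left (by positivity)
    apply pow_le_one₀ (by positivity)
    rw [← NNReal.coe_le_coe]
    simp
    norm_num
  have hu : Good2 a b s (4 * K) _ _ _ := ⟨(g1.smul (1 / 2)).mono le_rfl hh, (g2.smul (1 / 2)).mono le_rfl hh⟩
  obtain ⟨P1, P2, hP⟩ := hC _ _ _ _ hu (p + 1)
  have hre : (fun t => powC (fun l => 1 / 2 * addConj (expJ a b t φ) l) (p + 1))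
      = fun t => Gop p (expJ a b t φ) := by
    funext t
    unfold Gop
    congr 1
    funext l
    unfold reC addConj
    ring
  beta_reduce at hP
  rw [hre] at hP
  have e1 := hP.1.exp
  have e2 := (hP.2.add hP.1.wmul).exp
  have hd1 : ∀ t l, dFt a b p t φ l = Complex.I / zeta a b l * expJ a b (-t) (fun l => P1 t l +
      -(Complex.I * zeta a b l) * Gop p (expJ a b t φ) l) l := by
    intro t l
    unfold dFt
    have h := (e1.1 t l).const_mul (Complex.I / zeta a b l)
    rw [← h.deriv]
    congr 1
    funext τ
    simp only [Ft, Fop, expJ, opJinv]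
    ring
  obtain ⟨R, hRd⟩ : ∃ R, Good a b s _ _ R := ⟨_, e2⟩
  obtain ⟨hd, A0, A1, b0, b1, n0, n1⟩ := hRd
  have hd2 : ∀ l, d2Ft a b p t φ l = 1 * (Complex.I / zeta a b l * R t l) := by
    intro l
    unfold d2Ft
    have h := (hd t l).const_mul (Complex.I / zeta a b l)
    rw [one_mul]
    rw [← h.deriv]
    congr 1
    funext τ
    exact hd1 τ l
  refine (sob_final 1 _ _ hd2 ((NN_mono a b le_rfl (b1 t)).trans n1)).trans (le_of_eq ?_)
  have : ((4 * (2 * ((C * (4 * K)) ^ (p + 1) + (C * (4 * K)) ^ (p + 1))) : ℝ≥0) : ℝ)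
     = 16 * (C * 4) ^ (p + 1) * (x ^ (p + 1)) ^ 2 := by
    push_cast
    rw [hK, Real.coe_toNNReal _ (by positivity)]
    ring
  rw [this]
  rw [norm_one, one_pow, one_mul, Real.sqrt_mul (by positivity), Real.sqrt_sq (by positivity)]

lemma part_two (hab : a < b) (p : ℕ) {s : ℝ} (hs : 1 ≤ s) :
    ∃ C : ℝ, 0 ≤ C ∧ ∀ (t : ℝ) (φ η : ℤ → ℂ), MemHs a b s φ → MemHs a b s η →
        sobNorm a b s (dFtd a b p t φ η) ≤ C * sobNorm a b s φ ^ p * sobNorm a b s η := by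
  obtain ⟨C, hC⟩ := good_pow hab hs
  obtain ⟨D, hD⟩ := good_conv hab hs
  set c : ℂ := ((p : ℂ) + 1) / 2 ^ (p + 1) with hc
  refine ⟨Real.sqrt (‖c‖ ^ 2 * (16 * D * (C * 4) ^ p)), Real.sqrt_nonneg _, fun t φ η hφ hη => ?_⟩
  set x := sobNorm a b s φ with hx
  set y := sobNorm a b s η with hy
  have hx0 : 0 ≤ x := Real.sqrt_nonneg _
  have hy0 : 0 ≤ y := Real.sqrt_nonneg _
  have hN := memHs_NN hφ
  have hM := memHs_NN hη
  rw [← hx] at hN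
  rw [← hy] at hM
  set K := (x ^ 2).toNNReal with hK
  set L := (y ^ 2).toNNReal with hL
  obtain ⟨P1, hP⟩ := hC _ _ _ (good_lin φ hN) p
  obtain ⟨R, hRd⟩ : ∃ R, Good a b s _ _ R := ⟨_, (hD _ _ _ _ _ _ hP (good_lin η hM)).exp⟩
  obtain ⟨hd, A0, A1, b0, b1, n0, n1⟩ := hRd
  have hd2 : ∀ l, dFtd a b p t φ η l = c * (Complex.I / zeta a b l * R t l) := by
    intro l
    unfold dFtd
    have h := ((hd t l).const_mul (Complex.I / zeta a b l)).const_mul c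
    rw [← h.deriv]
    congr 1
    funext τ
    simp only [Ftd, Fd, expJ, opJinv, hc]
    ring
  refine (sob_final c _ _ hd2 ((NN_mono a b le_rfl (b1 t)).trans n1)).trans (le_of_eq ?_)
  have : ‖c‖ ^ 2 * ((4 * (D * ((C * (4 * K)) ^ p * (4 * L))) : ℝ≥0) : ℝ)
     = ‖c‖ ^ 2 * (16 * D * (C * 4) ^ p) * (x ^ p * y) ^ 2 := by
    push_cast
    rw [hK, hL, Real.coe_toNNReal _ (by positivity), Real.coe_toNNReal _ (by positivity)]
    ring
  rw [this, Real.sqrt_mul (by positivity), Real.sqrt_sq (by positivity), ← mul_assoc]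

/-- Bounds `‖∂_t² F_t(φ)‖_s ≤ C‖φ‖_{s+1}^{p+1}` (for
`φ ∈ H^{s+1}`) and `‖∂_t F_t'(φ)(η)‖_s ≤ C‖φ‖_s^p ‖η‖_s` (for `φ, η ∈ H^s`),
`s ≥ 1`, uniformly in `t`. -/
theorem dFt_second_bounds (a b : ℝ) (hab : a < b) (p : ℕ) (hp : 1 ≤ p)
    (s : ℝ) (hs : 1 ≤ s) :
    ∃ C > 0,
      (∀ (t : ℝ) (φ : ℤ → ℂ), MemHs a b (s + 1) φ →
        sobNorm a b s (d2Ft a b p t φ) ≤ C * sobNorm a b (s + 1) φ ^ (p + 1)) ∧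
      (∀ (t : ℝ) (φ η : ℤ → ℂ), MemHs a b s φ → MemHs a b s η →
        sobNorm a b s (dFtd a b p t φ η) ≤ C * sobNorm a b s φ ^ p * sobNorm a b s η) := by
  obtain ⟨C1, h1, H1⟩ := part_one hab p hs
  obtain ⟨C2, h2, H2⟩ := part_two hab p hs
  have hn : ∀ (σ : ℝ) (c : ℤ → ℂ), 0 ≤ sobNorm a b σ c := fun _ _ => Real.sqrt_nonneg _
  refine ⟨C1 + C2 + 1, by positivity, fun t φ hφ => ?_, fun t φ η hφ hη => ?_⟩
  · refine (H1 t φ hφ).trans (mul_le_mul_of_nonneg_right (by linarith) (pow_nonneg (hn _ _) _))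
  · refine (H2 t φ η hφ hη).trans (mul_le_mul_of_nonneg_right
      (mul_le_mul_of_nonneg_right (by linarith) (pow_nonneg (hn _ _) _)) (hn _ _))

end NKGE
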